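/- arXiv:1911.11611 — 3 statements merged into one kernel-verified Lean document; each statement's English description precedes it below -/
import Mathlib

section
/- Let A be an n×n real matrix and B an n×m real matrix such that the pair (A,B) is stabilizable, let Q be an n×n real symmetric positive semidefinite matrix, R an m×m real symmetric positive definite matrix, and ρ > 0. Then there exists an n×n real symmetric positive definite matrix P such that AᵀP + PA − ρ·PBR⁻¹BᵀP + Q is negative definite. -/
open Matrix

/-- A real square matrix is Hurwitz if all eigenvalues of its complexification have
negative real part. -/
def IsHurwitz {n : Type*} [Fintype n] [DecidableEq n] (A : Matrix n n ℝ) : Prop :=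
  ∀ μ ∈ spectrum ℂ (A.map (Complex.ofReal)), μ.re < 0

section Lyapunov

variable {n : Type*} [Fintype n] [DecidableEq n]

open scoped Matrix.Norms.L2Operator in
theorem posDef_smul_one_sub_transpose_mul_self {T : Matrix n n ℝ} {c : ℝ} (h : ‖T‖ ^ 2 < c) :
    (c • (1 : Matrix n n ℝ) - Tᵀ * T).PosDef := by
  refine .of_dotProduct_mulVec_pos ?_ fun x hx => ?_
  · simp [IsHermitian, conjTranspose_eq_transpose_of_trivial]
  · have h1 := T.l2_opNorm_mulVec (WithLp.toLp 2 x)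
    have h2 : ‖(EuclideanSpace.equiv n ℝ).symm (T *ᵥ x)‖ ^ 2 = (T *ᵥ x) ⬝ᵥ (T *ᵥ x) := by
      rw [EuclideanSpace.real_norm_sq_eq]
      simp [dotProduct, sq]
    have h3 : ‖WithLp.toLp 2 x‖ ^ 2 = x ⬝ᵥ x := by
      rw [EuclideanSpace.real_norm_sq_eq]
      simp [dotProduct, sq]
    have h4 : 0 < x ⬝ᵥ x := by simpa using dotProduct_star_self_pos_iff.mpr hx
    have h5 : (T *ᵥ x) ⬝ᵥ (T *ᵥ x) ≤ ‖T‖ ^ 2 * (x ⬝ᵥ x) := by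
      rw [← h2, ← h3, ← mul_pow]
      exact pow_le_pow_left₀ (norm_nonneg _) h1 2
    have h6 : x ⬝ᵥ ((Tᵀ * T) *ᵥ x) = (T *ᵥ x) ⬝ᵥ (T *ᵥ x) := by
      rw [← mulVec_mulVec, dotProduct_mulVec, vecMul_transpose]
    simp only [star_trivial, sub_mulVec, smul_mulVec, one_mulVec, dotProduct_sub, dotProduct_smul,
      smul_eq_mul, h6]
    nlinarith

open scoped MatrixOrder Matrix.Norms.L2Operator in
theorem exists_pos_smul_sub_posDef {W S : Matrix n n ℝ} (hW : W.PosDef) (hS : S.PosSemidef) :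
    ∃ k : ℝ, 0 < k ∧ (k • W - S).PosDef := by
  obtain ⟨U, rfl⟩ := CStarAlgebra.nonneg_iff_eq_star_mul_self.mp hW.posSemidef.nonneg
  obtain ⟨C, rfl⟩ := CStarAlgebra.nonneg_iff_eq_star_mul_self.mp hS.nonneg
  have hU : IsUnit U := isUnit_of_mul_isUnit_right hW.isUnit
  have hdet : IsUnit U.det := (isUnit_iff_isUnit_det U).mp hU
  refine ⟨‖C * U⁻¹‖ ^ 2 + 1, by positivity, ?_⟩
  have h := (IsUnit.posDef_star_left_conjugate_iff hU).mpr
    (posDef_smul_one_sub_transpose_mul_self (lt_add_one (‖C * U⁻¹‖ ^ 2)))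
  have hC : C * U⁻¹ * U = C := by rw [mul_assoc, nonsing_inv_mul U hdet, mul_one]
  convert h using 1
  have : star U * ((C * U⁻¹)ᵀ * (C * U⁻¹)) * U = star (C * U⁻¹ * U) * (C * U⁻¹ * U) := by
    rw [star_mul (C * U⁻¹), star_eq_conjTranspose (C * U⁻¹), conjTranspose_eq_transpose_of_trivial]
    noncomm_ring
  rw [mul_sub, sub_mul, this, hC]
  simp

open Filter Topology in
open scoped ENNReal in
theorem tendsto_pow_zero_of_spectralRadius_lt_one {E : Type*} [NormedRing E] [NormedAlgebra ℂ E]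
    [CompleteSpace E] {a : E} (h : spectralRadius ℂ a < 1) :
    Tendsto (fun k : ℕ => a ^ k) atTop (𝓝 0) := by
  obtain ⟨r, hr, hr1⟩ := ENNReal.lt_iff_exists_nnreal_btwn.mp h
  have hr1' : r < 1 := by exact_mod_cast hr1
  have hG := spectrum.pow_nnnorm_pow_one_div_tendsto_nhds_spectralRadius a
  refine squeeze_zero_norm' ?_
    (tendsto_pow_atTop_nhds_zero_of_lt_one r.coe_nonneg (by exact_mod_cast hr1'))
  filter_upwards [hG.eventually (gt_mem_nhds hr), eventually_gt_atTop 0] with k hk hk0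
  have hk0' : (0 : ℝ) < k := by exact_mod_cast hk0
  have h1 : (‖a ^ k‖₊ : ℝ≥0∞) ≤ (r : ℝ≥0∞) ^ k := by
    have h2 := ENNReal.rpow_le_rpow hk.le hk0'.le
    rwa [← ENNReal.rpow_mul, one_div_mul_cancel hk0'.ne', ENNReal.rpow_one,
      ENNReal.rpow_natCast] at h2
  exact_mod_cast h1

open scoped Matrix.Norms.L2Operator in
open Filter Topology in
theorem exists_posDef_stein [Nonempty n] {N : Matrix n n ℝ}
    (hN : ∀ z ∈ spectrum ℂ (N.map Complex.ofReal), ‖z‖ < 1) :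
    ∃ P : Matrix n n ℝ, P.PosDef ∧ (P - Nᵀ * P * N).PosDef := by
  have hρ : spectralRadius ℂ (N.map Complex.ofReal) < 1 := by
    exact_mod_cast spectrum.spectralRadius_lt_of_forall_lt (r := 1) (N.map Complex.ofReal)
      fun z hz => by exact_mod_cast hN z hz
  have hlim := tendsto_pow_zero_of_spectralRadius_lt_one hρ
  have hlim' : Tendsto (fun k : ℕ => N ^ k) atTop (𝓝 0) := by
    have hc : Continuous fun M : Matrix n n ℂ => M.map Complex.re :=
      continuous_id.matrix_map Complex.continuous_re
    have := (hc.tendsto 0).comp hlim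
    convert this using 1
    · funext k
      have h : N.map Complex.ofReal ^ k = (N ^ k).map Complex.ofReal :=
        (map_pow (Complex.ofRealHom.mapMatrix) N k).symm
      ext i j
      simp [h]
    · ext; simp
  have hev : ∀ᶠ k : ℕ in atTop, ‖N ^ k‖ < 1 := by
    simpa using hlim'.norm.eventually (gt_mem_nhds (by simp))
  obtain ⟨k, hk, hk0⟩ := (hev.and (eventually_gt_atTop 0)).exists
  have hfin : ∀ j : ℕ, (∑ i ∈ Finset.range j, (N ^ i)ᵀ * N ^ i) -
      Nᵀ * (∑ i ∈ Finset.range j, (N ^ i)ᵀ * N ^ i) * N = 1 - (N ^ j)ᵀ * N ^ j := by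
    intro j
    rw [Finset.mul_sum, Finset.sum_mul, ← Finset.sum_sub_distrib]
    have := Finset.sum_range_sub' (fun i => (N ^ i)ᵀ * N ^ i) j
    simp only [pow_zero, transpose_one, mul_one] at this
    rw [← this]
    refine Finset.sum_congr rfl fun i _ => ?_
    rw [pow_succ, transpose_mul]
    noncomm_ring
  refine ⟨∑ i ∈ Finset.range k, (N ^ i)ᵀ * N ^ i, ?_, ?_⟩
  · obtain ⟨j, rfl⟩ := Nat.exists_eq_succ_of_ne_zero hk0.ne'
    rw [Finset.sum_range_succ']
    refine PosDef.posSemidef_add (posSemidef_sum _ fun i _ => ?_) (by simpa using PosDef.one)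
    simpa [conjTranspose_eq_transpose_of_trivial] using
      posSemidef_conjTranspose_mul_self (N ^ (i + 1))
  · rw [hfin]
    have := posDef_smul_one_sub_transpose_mul_self (T := N ^ k) (c := 1)
      (by nlinarith [norm_nonneg (N ^ k)])
    rwa [one_smul] at this

theorem Complex.norm_lt_one_of_cayley_re_neg {z : ℂ} (hz : ((z - 1) / (z + 1)).re < 0) :
    ‖z‖ < 1 := by
  have h : ((z - 1) / (z + 1)).re = (‖z‖ ^ 2 - 1) / Complex.normSq (z + 1) := by
    rw [Complex.div_re, ← Complex.normSq_eq_norm_sq, Complex.normSq_apply z]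
    simp
    ring
  rw [h] at hz
  by_contra! hle
  exact hz.not_ge (div_nonneg (by nlinarith) (Complex.normSq_nonneg _))

theorem IsHurwitz.exists_posDef_lyapunov {M : Matrix n n ℝ} (hM : IsHurwitz M) :
    ∃ P : Matrix n n ℝ, P.PosDef ∧ (-(Mᵀ * P + P * M)).PosDef := by
  cases isEmpty_or_nonempty n
  · exact ⟨1, .one, by simpa only [Subsingleton.elim (-(Mᵀ * 1 + 1 * M)) 1] using PosDef.one⟩
  set f : Matrix n n ℝ →+* Matrix n n ℂ := Complex.ofRealHom.mapMatrix with hf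
  have hfM : ∀ X : Matrix n n ℝ, X.map Complex.ofReal = f X := fun _ => rfl
  unfold IsHurwitz at hM
  simp only [hfM] at hM
  have hunit : IsUnit (1 - M) := by
    have h1 : IsUnit (f (1 - M)) := by
      by_contra h
      have := hM 1 (by rw [spectrum.mem_iff]; simpa using h)
      norm_num at this
    rw [isUnit_iff_isUnit_det, isUnit_iff_ne_zero] at h1 ⊢
    rw [hf, ← RingHom.map_det] at h1
    exact fun h0 => h1 (by rw [h0, map_zero])
  have hdet : IsUnit (1 - M).det := (isUnit_iff_isUnit_det _).mp hunit
  set N := (1 + M) * (1 - M)⁻¹ with hNdef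
  have hN : N * (1 - M) = 1 + M := by
    rw [hNdef, mul_assoc, nonsing_inv_mul _ hdet, mul_one]
  have hspec : ∀ z ∈ spectrum ℂ (f N), ‖z‖ < 1 := by
    intro z hz
    have key : (algebraMap ℂ _ z - f N) * f (1 - M) =
        (z - 1) • (1 : Matrix n n ℂ) - (z + 1) • f M := by
      rw [sub_mul, ← map_mul, hN, Algebra.algebraMap_eq_smul_one, map_sub, map_add, map_one,
        smul_mul_assoc, one_mul]
      module
    have hnot : ¬ IsUnit ((z - 1) • (1 : Matrix n n ℂ) - (z + 1) • f M) := by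
      rw [← key]
      intro h
      obtain ⟨u, hu⟩ := hunit.map f
      rw [← hu, Units.isUnit_mul_units] at h
      exact (spectrum.mem_iff.mp hz) h
    by_cases hz1 : z + 1 = 0
    · exfalso
      apply hnot
      rw [hz1, zero_smul, sub_zero, ← Algebra.algebraMap_eq_smul_one]
      refine (IsUnit.mk0 (z - 1) ?_).map _
      intro h
      have : (2 : ℂ) = (z + 1) - (z - 1) := by ring
      rw [hz1, h] at this
      norm_num at this
    · apply Complex.norm_lt_one_of_cayley_re_neg
      apply hM
      rw [spectrum.mem_iff]
      intro h
      apply hnot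
      have : (z - 1) • (1 : Matrix n n ℂ) - (z + 1) • f M =
          Units.mk0 (z + 1) hz1 • (algebraMap ℂ _ ((z - 1) / (z + 1)) - f M) := by
        rw [Units.smul_def, Units.val_mk0, smul_sub, Algebra.algebraMap_eq_smul_one, smul_smul,
          mul_div_cancel₀ _ hz1]
      rw [this]
      exact h.smul _
  obtain ⟨P, hP, hPN⟩ := exists_posDef_stein hspec
  refine ⟨P, hP, ?_⟩
  have h := ((IsUnit.posDef_star_left_conjugate_iff hunit).mpr hPN).smul
    (show (0 : ℝ) < 1 / 2 by norm_num)
  convert h using 1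
  have h1 : star (1 - M) * (P - Nᵀ * P * N) * (1 - M) =
      (1 - M)ᵀ * P * (1 - M) - (N * (1 - M))ᵀ * P * (N * (1 - M)) := by
    rw [star_eq_conjTranspose, conjTranspose_eq_transpose_of_trivial, transpose_mul N]
    noncomm_ring
  have h2 : (1 - M)ᵀ * P * (1 - M) - (1 + M)ᵀ * P * (1 + M) = (2 : ℝ) • -(Mᵀ * P + P * M) := by
    rw [transpose_sub, transpose_add, transpose_one, two_smul]
    noncomm_ring
  rw [h1, hN, h2, smul_smul]
  norm_num

end Lyapunov

/-- If `(A,B)` is stabilizable, `Q ⪰ 0`, `R ≻ 0`, `ρ > 0`, then there is a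
symmetric positive definite `P` with `AᵀP + PA − ρ·PBR⁻¹BᵀP + Q < 0`. -/
theorem stmt4 {n m : ℕ} (A : Matrix (Fin n) (Fin n) ℝ) (B : Matrix (Fin n) (Fin m) ℝ)
    (hstab : ∃ F : Matrix (Fin m) (Fin n) ℝ, IsHurwitz (A + B * F))
    (Q : Matrix (Fin n) (Fin n) ℝ) (hQ : Q.PosSemidef)
    (R : Matrix (Fin m) (Fin m) ℝ) (hR : R.PosDef)
    (ρ : ℝ) (hρ : 0 < ρ) :
    ∃ P : Matrix (Fin n) (Fin n) ℝ, P.PosDef ∧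
      (-(Aᵀ * P + P * A - ρ • (P * B * R⁻¹ * Bᵀ * P) + Q)).PosDef := by
  obtain ⟨F, hF⟩ := hstab
  obtain ⟨P, hP, hW⟩ := hF.exists_posDef_lyapunov
  have hS : (ρ⁻¹ • (Fᵀ * R * F) + Q).PosSemidef := by
    have h := (hR.posSemidef.conjTranspose_mul_mul_same F).smul (inv_pos.mpr hρ).le
    rw [conjTranspose_eq_transpose_of_trivial] at h
    exact h.add hQ
  obtain ⟨k, hk, hkW⟩ := exists_pos_smul_sub_posDef hW hS
  refine ⟨k • P, hP.smul hk, ?_⟩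
  have hPt : Pᵀ = P := by
    simpa [IsHermitian, conjTranspose_eq_transpose_of_trivial] using hP.isHermitian
  have hRt : Rᵀ = R := by
    simpa [IsHermitian, conjTranspose_eq_transpose_of_trivial] using hR.isHermitian
  have hRdet : IsUnit R.det := (isUnit_iff_isUnit_det _).mp hR.isUnit
  set Z := (ρ * k) • (R⁻¹ * Bᵀ * P) + F with hZ
  have hsq := (hR.posSemidef.conjTranspose_mul_mul_same Z).smul (inv_pos.mpr hρ).le
  convert hkW.add_posSemidef hsq using 1
  have hRZ : R * Z = (ρ * k) • (Bᵀ * P) + R * F := by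
    rw [hZ, Matrix.mul_add, Matrix.mul_smul, ← Matrix.mul_assoc, ← Matrix.mul_assoc,
      mul_nonsing_inv _ hRdet, Matrix.one_mul]
  have hZt : Zᴴ = (ρ * k) • (P * B * R⁻¹) + Fᵀ := by
    rw [conjTranspose_eq_transpose_of_trivial, hZ]
    simp [transpose_mul, transpose_nonsing_inv, hPt, hRt, Matrix.mul_assoc]
  have hcancel : P * B * R⁻¹ * (R * F) = P * B * F := by
    rw [Matrix.mul_assoc (P * B), ← Matrix.mul_assoc R⁻¹, nonsing_inv_mul _ hRdet, Matrix.one_mul]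
  rw [Matrix.mul_assoc Zᴴ, hRZ, hZt]
  simp only [Matrix.add_mul, Matrix.mul_add, Matrix.smul_mul, Matrix.mul_smul, hcancel,
    transpose_add, transpose_mul, smul_add, smul_neg, neg_add, smul_smul]
  simp only [← Matrix.mul_assoc]
  have e1 : ρ⁻¹ * (ρ * k * (ρ * k)) = ρ * (k * k) := by field_simp
  have e2 : ρ⁻¹ * (ρ * k) = k := by field_simp
  simp only [e1, e2]
  module
end

section
/- Let Γ be an N×N real symmetric matrix, A an n×n real matrix, B an n×m real matrix and K an m×n real matrix. Then the matrix I_N ⊗ A + Γ ⊗ BK is Hurwitz if and only if for every (real) eigenvalue λ of Γ the matrix A + λBK is Hurwitz. -/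
open Matrix Kronecker

namespace Matrix

theorem charpoly_blockDiagonal {R n o : Type*} [CommRing R] [Fintype n] [DecidableEq n]
    [Fintype o] [DecidableEq o] (M : o → Matrix n n R) :
    (blockDiagonal M).charpoly = ∏ i, (M i).charpoly := by
  simp only [charpoly]
  rw [← det_blockDiagonal]
  congr 1
  ext ⟨i, k⟩ ⟨j, l⟩
  by_cases h : k = l <;> by_cases h' : i = j <;>
    simp [blockDiagonal_apply, h, h']

theorem charpoly_one_kronecker_add_diagonal_kronecker {R n o : Type*} [CommRing R]
    [Fintype n] [DecidableEq n] [Fintype o] [DecidableEq o] (d : o → R) (A C : Matrix n n R) :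
    ((1 : Matrix o o R) ⊗ₖ A + diagonal d ⊗ₖ C).charpoly = ∏ i, (A + d i • C).charpoly := by
  rw [← charpoly_blockDiagonal, ← charpoly_reindex (Equiv.prodComm o n)]
  congr 1
  ext ⟨i, k⟩ ⟨j, l⟩
  by_cases h : k = l <;> simp [blockDiagonal_apply, h]

theorem IsHermitian.charpoly_one_kronecker_add_kronecker {n o : Type*}
    [Fintype n] [DecidableEq n] [Fintype o] [DecidableEq o] {G : Matrix o o ℝ}
    (hG : G.IsHermitian) (A C : Matrix n n ℝ) :
    ((1 : Matrix o o ℝ) ⊗ₖ A + G ⊗ₖ C).charpoly = ∏ i, (A + hG.eigenvalues i • C).charpoly := by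
  set U : Matrix o o ℝ := (hG.eigenvectorUnitary).1
  have hU : U * star U = 1 := Unitary.coe_mul_star_self hG.eigenvectorUnitary
  have hU' : star U * U = 1 := Unitary.coe_star_mul_self hG.eigenvectorUnitary
  have hG' : G = U * diagonal hG.eigenvalues * star U := by
    conv_lhs => rw [hG.spectral_theorem, Unitary.conjStarAlgAut_apply]
    rfl
  have h : (1 : Matrix o o ℝ) ⊗ₖ A + G ⊗ₖ C =
      (U ⊗ₖ (1 : Matrix n n ℝ)) *
        (((1 : Matrix o o ℝ) ⊗ₖ A + diagonal hG.eigenvalues ⊗ₖ C) *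
          (star U ⊗ₖ (1 : Matrix n n ℝ))) := by
    simp only [Matrix.add_mul, Matrix.mul_add, ← mul_kronecker_mul, Matrix.one_mul,
      Matrix.mul_one, hU, ← Matrix.mul_assoc, ← hG']
  rw [h, charpoly_mul_comm, Matrix.mul_assoc, ← mul_kronecker_mul, hU', Matrix.one_mul,
    one_kronecker_one, Matrix.mul_one, charpoly_one_kronecker_add_diagonal_kronecker]

end Matrix

theorem isHurwitz_iff_charpoly {n : Type*} [Fintype n] [DecidableEq n] (A : Matrix n n ℝ) :
    IsHurwitz A ↔ ∀ μ : ℂ, (A.charpoly.map Complex.ofRealHom).IsRoot μ → μ.re < 0 := by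
  rw [← Matrix.charpoly_map]
  simp only [← Matrix.mem_spectrum_iff_isRoot_charpoly]
  rfl

/-- For symmetric `Γ`, the matrix `I_N ⊗ A + Γ ⊗ BK` is Hurwitz iff
`A + λBK` is Hurwitz for every real eigenvalue `λ` of `Γ`. -/
theorem stmt11 {N n m : ℕ} (Γ : Matrix (Fin N) (Fin N) ℝ) (hΓ : Γ.IsHermitian)
    (A : Matrix (Fin n) (Fin n) ℝ) (B : Matrix (Fin n) (Fin m) ℝ)
    (K : Matrix (Fin m) (Fin n) ℝ) :
    IsHurwitz ((1 : Matrix (Fin N) (Fin N) ℝ) ⊗ₖ A + Γ ⊗ₖ (B * K))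
      ↔ ∀ lam ∈ spectrum ℝ Γ, IsHurwitz (A + lam • (B * K)) := by
  rw [hΓ.spectrum_real_eq_range_eigenvalues, Set.forall_mem_range]
  simp only [isHurwitz_iff_charpoly, hΓ.charpoly_one_kronecker_add_kronecker,
    Polynomial.map_prod, Polynomial.isRoot_prod, Finset.mem_univ, true_and]
  exact ⟨fun h i μ hμ => h μ ⟨i, hμ⟩, fun h μ ⟨i, hμ⟩ => h i μ hμ⟩
end

section
/- Let A be an n×n real matrix, B an n×m real matrix, and let Q̄₁, Q̄₂ be n×n real symmetric positive semidefinite matrices and R̄₁, R̄₂ be m×m real symmetric positive definite matrices with Q̄₂ − Q̄₁ positive semidefinite and R̄₂ − R̄₁ positive semidefinite. Suppose P₁ and P₂ are n×n real symmetric positive definite matrices satisfying the algebraic Riccati equations AᵀP₁ + P₁A − P₁BR̄₁⁻¹BᵀP₁ + Q̄₁ = 0 and AᵀP₂ + P₂A − P₂BR̄₂⁻¹BᵀP₂ + Q̄₂ = 0, such that A − BR̄₁⁻¹BᵀP₁ and A − BR̄₂⁻¹BᵀP₂ are Hurwitz. Then P₂ − P₁ is positive semidefinite. -/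
open Matrix

open Filter Topology in
/-- Powers of a complex square matrix with spectrum in the open unit disc tend to zero. -/
theorem Matrix.tendsto_pow_zero_of_spectrum_norm_lt_one {n : Type*} [Fintype n] [DecidableEq n]
    (C : Matrix n n ℂ) (hC : ∀ z ∈ spectrum ℂ C, ‖z‖ < 1) :
    Tendsto (fun k : ℕ => C ^ k) atTop (𝓝 0) := by
  let _ : NormedRing (Matrix n n ℂ) := Matrix.linftyOpNormedRing
  let _ : NormedAlgebra ℂ (Matrix n n ℂ) := Matrix.linftyOpNormedAlgebra
  rcases isEmpty_or_nonempty n with h | h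
  · exact tendsto_const_nhds.congr fun k => Subsingleton.elim _ _
  have : CompleteSpace (Matrix n n ℂ) := FiniteDimensional.complete ℂ _
  have hr : spectralRadius ℂ C < ((1 : NNReal) : ENNReal) :=
    spectrum.spectralRadius_lt_of_forall_lt_of_nonempty
      (spectrum.nonempty C) fun z hz => hC z hz
  obtain ⟨r, hr₁, hr₂⟩ := ENNReal.lt_iff_exists_nnreal_btwn.1 hr
  have hr₂' : r < 1 := by exact_mod_cast hr₂
  have hG := spectrum.pow_nnnorm_pow_one_div_tendsto_nhds_spectralRadius C
  suffices h : Tendsto (fun k : ℕ => ‖C ^ k‖) atTop (𝓝 0) from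
    tendsto_zero_iff_norm_tendsto_zero.2 h
  refine squeeze_zero' (Eventually.of_forall fun k => norm_nonneg _) ?_
    (tendsto_pow_atTop_nhds_zero_of_lt_one r.2 (by exact_mod_cast hr₂'))
  filter_upwards [hG.eventually (gt_mem_nhds hr₁), eventually_gt_atTop 0] with k hk hk0
  have hk' : (‖C ^ k‖₊ : ENNReal) < (r : ENNReal) ^ (k : ℝ) := by
    rwa [one_div, ENNReal.rpow_inv_lt_iff (by exact_mod_cast hk0)] at hk
  rw [ENNReal.rpow_natCast] at hk'
  have : ‖C ^ k‖₊ < r ^ k := by exact_mod_cast hk'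
  exact_mod_cast this.le

open Filter Topology in
/-- A symmetric matrix `X` satisfying the Stein inequality `Cᵀ X C ≤ X` is positive semidefinite
when the powers of `C` tend to zero. -/
theorem Matrix.posSemidef_of_stein {n : Type*} [Fintype n] [DecidableEq n]
    {C X : Matrix n n ℝ} (hX : X.IsHermitian) (hC : Tendsto (fun k : ℕ => C ^ k) atTop (𝓝 0))
    (h : (X - Cᵀ * X * C).PosSemidef) : X.PosSemidef := by
  have hk : ∀ k : ℕ, (X - (C ^ k)ᵀ * X * C ^ k).PosSemidef := by
    intro k
    induction k with
    | zero => simpa using PosSemidef.zero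
    | succ k ih =>
      have := (h.conjTranspose_mul_mul_same (C ^ k)).add ih
      convert this using 1
      rw [conjTranspose_eq_transpose_of_trivial, pow_succ', transpose_mul]
      noncomm_ring
  refine .of_dotProduct_mulVec_nonneg hX fun x => ?_
  have hlim : Tendsto (fun k : ℕ => star x ⬝ᵥ (X - (C ^ k)ᵀ * X * C ^ k) *ᵥ x) atTop
      (𝓝 (star x ⬝ᵥ X *ᵥ x)) := by
    have hc : Continuous fun D : Matrix n n ℝ => star x ⬝ᵥ (X - Dᵀ * X * D) *ᵥ x := by
      fun_prop
    simpa [Function.comp_def] using (hc.tendsto 0).comp hC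
  exact ge_of_tendsto' hlim fun k => (hk k).dotProduct_mulVec_nonneg x

theorem IsHurwitz.isUnit_sub_one {n : Type*} [Fintype n] [DecidableEq n] {M : Matrix n n ℝ}
    (hM : IsHurwitz M) : IsUnit (M - 1) := by
  have h : IsUnit (M.map Complex.ofReal - 1) := by
    have h1 : (1 : ℂ) ∉ spectrum ℂ (M.map Complex.ofReal) := fun h => by
      have := hM 1 h
      norm_num at this
    rw [spectrum.notMem_iff, map_one] at h1
    simpa using h1.neg
  have hmap : M.map Complex.ofReal - 1 = Complex.ofRealHom.mapMatrix (M - 1) := by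
    rw [map_sub, map_one]
    rfl
  rw [hmap, isUnit_iff_isUnit_det, ← RingHom.map_det, isUnit_iff_ne_zero] at h
  rw [isUnit_iff_isUnit_det, isUnit_iff_ne_zero]
  exact fun h0 => h (by rw [h0, map_zero])

open Filter Topology in
/-- Powers of the Cayley transform of a Hurwitz matrix tend to zero. -/
theorem IsHurwitz.tendsto_cayley_pow {n : Type*} [Fintype n] [DecidableEq n] {M C : Matrix n n ℝ}
    (hM : IsHurwitz M) (hC : C * (M - 1) = M + 1) :
    Tendsto (fun k : ℕ => C ^ k) atTop (𝓝 0) := by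
  set f : Matrix n n ℝ →+* Matrix n n ℂ := Complex.ofRealHom.mapMatrix with hf
  have hCf : f C * (f M - 1) = f M + 1 := by
    rw [← map_one f, ← map_sub, ← map_mul, hC, map_add]
  have hu : IsUnit (f M - 1) := by
    rw [← map_one f, ← map_sub]
    exact hM.isUnit_sub_one.map f
  have hspec : ∀ z ∈ spectrum ℂ (f C), ‖z‖ < 1 := by
    intro z hz
    have hkey : (algebraMap ℂ (Matrix n n ℂ) z - f C) * (f M - 1)
        = (z - 1) • f M - (z + 1) • (1 : Matrix n n ℂ) := by
      rw [sub_mul, hCf, Algebra.algebraMap_eq_smul_one, smul_mul_assoc, one_mul]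
      module
    have hnu : ¬ IsUnit ((z - 1) • f M - (z + 1) • (1 : Matrix n n ℂ)) := by
      rw [← hkey, hu.mul_right_iff]
      exact spectrum.mem_iff.1 hz
    have hz1 : z - 1 ≠ 0 := by
      intro h0
      apply hnu
      have : z + 1 = 2 := by linear_combination h0
      rw [h0, this, zero_smul, zero_sub, IsUnit.neg_iff, ← Algebra.algebraMap_eq_smul_one]
      exact (isUnit_iff_ne_zero.2 two_ne_zero).map _
    have hmem : (z + 1) / (z - 1) ∈ spectrum ℂ (M.map Complex.ofReal) := by
      rw [spectrum.mem_iff]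
      intro h
      apply hnu
      have h2 := (h.smul (Units.mk0 _ hz1)).neg
      convert h2 using 1
      change _ = -((z - 1) • (algebraMap ℂ (Matrix n n ℂ) _ - f M))
      rw [Algebra.algebraMap_eq_smul_one, smul_sub, smul_smul, mul_div_cancel₀ _ hz1]
      abel
    have hre := hM _ hmem
    have hpos : 0 < Complex.normSq (z - 1) := Complex.normSq_pos.2 hz1
    rw [Complex.div_re, ← add_div, div_neg_iff] at hre
    have hre' : (z + 1).re * (z - 1).re + (z + 1).im * (z - 1).im < 0 := by
      rcases hre with h | h
      · exact absurd h.2 (not_lt.2 hpos.le)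
      · exact h.1
    simp at hre'
    rw [← sq_lt_one_iff₀ (norm_nonneg z), Complex.sq_norm, Complex.normSq_apply]
    nlinarith
  have hlim := tendsto_pow_zero_of_spectrum_norm_lt_one (f C) hspec
  have hre : Continuous fun D : Matrix n n ℂ => D.map Complex.re :=
    continuous_id.matrix_map Complex.continuous_re
  have h0 := (hre.tendsto 0).comp hlim
  rw [Matrix.map_zero _ Complex.zero_re] at h0
  refine h0.congr fun k => ?_
  rw [Function.comp_apply, ← map_pow]
  ext i j
  simp [hf]

/-- Lyapunov's theorem: if `M` is Hurwitz and `Mᵀ X + X M` is negative semidefinite, then the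
symmetric matrix `X` is positive semidefinite. -/
theorem IsHurwitz.posSemidef_of_lyapunov {n : Type*} [Fintype n] [DecidableEq n]
    {M X : Matrix n n ℝ} (hM : IsHurwitz M) (hX : X.IsHermitian)
    (h : (-(Mᵀ * X + X * M)).PosSemidef) : X.PosSemidef := by
  obtain ⟨u, hu⟩ := hM.isUnit_sub_one
  set N : Matrix n n ℝ := ↑u⁻¹
  have hN : (M - 1) * N = 1 := by rw [← hu]; exact u.mul_inv
  have hN' : N * (M - 1) = 1 := by rw [← hu]; exact u.inv_mul
  refine posSemidef_of_stein (C := (M + 1) * N) hX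
    (hM.tendsto_cayley_pow (by rw [mul_assoc, hN', mul_one])) ?_
  have h2 := (h.add h).conjTranspose_mul_mul_same N
  convert h2 using 1
  have hNt : Nᵀ * (Mᵀ - 1) = 1 := by
    rw [← transpose_one, ← transpose_sub, ← transpose_mul, hN]
  have hXN : X = Nᵀ * (Mᵀ - 1) * X * ((M - 1) * N) := by
    rw [hN, hNt, one_mul, mul_one]
  rw [conjTranspose_eq_transpose_of_trivial, transpose_mul, transpose_add, transpose_one]
  nth_rewrite 1 [hXN]
  noncomm_ring

/-- Matrix inversion is antitone on positive definite matrices. -/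
theorem Matrix.PosDef.posSemidef_inv_sub_inv {m : Type*} [Fintype m] [DecidableEq m]
    {R₁ R₂ : Matrix m m ℝ} (h₁ : R₁.PosDef) (h₂ : R₂.PosDef) (h : (R₂ - R₁).PosSemidef) :
    (R₁⁻¹ - R₂⁻¹).PosSemidef := by
  have hs := (h.add (h₁.inv.posSemidef.conjTranspose_mul_mul_same
    (R₂ - R₁))).conjTranspose_mul_mul_same R₂⁻¹
  convert hs using 1
  rw [h.isHermitian.eq, h₂.inv.isHermitian.eq]
  have e₁ : R₁ * R₁⁻¹ = 1 := mul_nonsing_inv _ ((isUnit_iff_isUnit_det _).1 h₁.isUnit)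
  have e₁' : R₁⁻¹ * R₁ = 1 := nonsing_inv_mul _ ((isUnit_iff_isUnit_det _).1 h₁.isUnit)
  have e₂ : R₂ * R₂⁻¹ = 1 := mul_nonsing_inv _ ((isUnit_iff_isUnit_det _).1 h₂.isUnit)
  have e₂' : R₂⁻¹ * R₂ = 1 := nonsing_inv_mul _ ((isUnit_iff_isUnit_det _).1 h₂.isUnit)
  have key : R₂ - R₁ + (R₂ - R₁) * R₁⁻¹ * (R₂ - R₁) = R₂ * R₁⁻¹ * R₂ - R₂ := by
    simp only [sub_mul, mul_sub, e₁, one_mul]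
    rw [mul_assoc R₂ R₁⁻¹ R₁, e₁', mul_one]
    abel
  rw [key, mul_sub, sub_mul, e₂', one_mul, ← mul_assoc, ← mul_assoc, e₂', one_mul,
    mul_assoc, e₂, mul_one]

/-- comparison of stabilizing solutions of algebraic Riccati equations:
if `Q̄₁ ⪯ Q̄₂` and `R̄₁ ⪯ R̄₂`, then the stabilizing solutions satisfy `P₁ ⪯ P₂`. -/
theorem stmt18 {n m : ℕ} (A : Matrix (Fin n) (Fin n) ℝ) (B : Matrix (Fin n) (Fin m) ℝ)
    (Q₁ Q₂ : Matrix (Fin n) (Fin n) ℝ) (hQ1 : Q₁.PosSemidef) (hQ2 : Q₂.PosSemidef)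
    (hQ : (Q₂ - Q₁).PosSemidef)
    (R₁ R₂ : Matrix (Fin m) (Fin m) ℝ) (hR1 : R₁.PosDef) (hR2 : R₂.PosDef)
    (hRmono : (R₂ - R₁).PosSemidef)
    (P₁ P₂ : Matrix (Fin n) (Fin n) ℝ) (hP1 : P₁.PosDef) (hP2 : P₂.PosDef)
    (hric1 : Aᵀ * P₁ + P₁ * A - P₁ * B * R₁⁻¹ * Bᵀ * P₁ + Q₁ = 0)
    (hric2 : Aᵀ * P₂ + P₂ * A - P₂ * B * R₂⁻¹ * Bᵀ * P₂ + Q₂ = 0)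
    (hH1 : IsHurwitz (A - B * R₁⁻¹ * Bᵀ * P₁))
    (hH2 : IsHurwitz (A - B * R₂⁻¹ * Bᵀ * P₂)) :
    (P₂ - P₁).PosSemidef := by
  have hX : (P₂ - P₁).IsHermitian := hP2.isHermitian.sub hP1.isHermitian
  refine hH2.posSemidef_of_lyapunov hX ?_
  have hP1t : P₁ᵀ = P₁ := hP1.isHermitian
  have hP2t : P₂ᵀ = P₂ := hP2.isHermitian
  have hR2t : (R₂⁻¹)ᵀ = R₂⁻¹ := hR2.inv.isHermitian
  have hS := hR2.inv.posSemidef.conjTranspose_mul_mul_same (Bᵀ * (P₂ - P₁))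
  have hD := (hR1.posSemidef_inv_sub_inv hR2 hRmono).conjTranspose_mul_mul_same (Bᵀ * P₁)
  suffices h : -((A - B * R₂⁻¹ * Bᵀ * P₂)ᵀ * (P₂ - P₁) + (P₂ - P₁) * (A - B * R₂⁻¹ * Bᵀ * P₂)) =
      (Bᵀ * (P₂ - P₁))ᴴ * R₂⁻¹ * (Bᵀ * (P₂ - P₁)) +
        (Bᵀ * P₁)ᴴ * (R₁⁻¹ - R₂⁻¹) * (Bᵀ * P₁) + (Q₂ - Q₁) by
    rw [h]
    exact (hS.add hD).add hQ
  simp only [conjTranspose_eq_transpose_of_trivial, transpose_mul, transpose_sub,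
    transpose_transpose, hP1t, hP2t, hR2t]
  have e₁ : Q₁ = P₁ * B * R₁⁻¹ * Bᵀ * P₁ - (Aᵀ * P₁ + P₁ * A) := by
    rw [← sub_eq_zero, ← hric1]
    abel
  have e₂ : Q₂ = P₂ * B * R₂⁻¹ * Bᵀ * P₂ - (Aᵀ * P₂ + P₂ * A) := by
    rw [← sub_eq_zero, ← hric2]
    abel
  rw [e₁, e₂]
  simp only [Matrix.mul_sub, Matrix.sub_mul, Matrix.mul_assoc]
  abel
end
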